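/- arXiv:2108.08613 — 5 statements merged into one kernel-verified Lean document; each statement's English description precedes it below -/
import Mathlib

section
/- Let d ≥ 1 and let a, b ∈ {0,1}^d. The string p(b) is a subsequence of the string s(a) if and only if a and b are orthogonal (i.e., a[i]·b[i] = 0 for every coordinate i). -/
/-- The four-letter alphabet Σ = {0, 1, x, $}. -/
inductive EpSym : Type
  | zero | one | x | dollar
  deriving DecidableEq

/-- The symbol (0 or 1) corresponding to a Boolean vector entry. -/
def symOf (v : Bool) : EpSym := if v then EpSym.one else EpSym.zero

/-- The coordinate gadget: s(a[i]) = 01 if a[i] = 0, and 00 if a[i] = 1. -/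
def coordGadget (v : Bool) : List EpSym :=
  if v then [EpSym.zero, EpSym.zero] else [EpSym.zero, EpSym.one]

/-- p(b) = b[1] x b[2] x ⋯ x b[d]. -/
def pStr {d : ℕ} (b : Fin d → Bool) : List EpSym :=
  List.intersperse EpSym.x (List.ofFn fun i => symOf (b i))

/-- s(a) = s(a[1]) x s(a[2]) x ⋯ x s(a[d]). -/
def sStr {d : ℕ} (a : Fin d → Bool) : List EpSym :=
  List.intercalate [EpSym.x] (List.ofFn fun i => coordGadget (a i))

/-- Two vectors a, b ∈ {0,1}^d are orthogonal if a[i]·b[i] = 0 for all i. -/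
def Orthogonal {d : ℕ} (a b : Fin d → Bool) : Prop :=
  ∀ i, (a i && b i) = false

theorem pStr_succ_succ {n : ℕ} (b : Fin (n + 2) → Bool) :
    pStr b = symOf (b 0) :: EpSym.x :: pStr fun i : Fin (n + 1) => b i.succ := by
  simp [pStr, List.ofFn_succ]

theorem sStr_succ_succ {n : ℕ} (a : Fin (n + 2) → Bool) :
    sStr a = coordGadget (a 0) ++ EpSym.x :: sStr fun i : Fin (n + 1) => a i.succ := by
  simp [sStr, List.intercalate, List.ofFn_succ]

theorem count_x_pStr {n : ℕ} (b : Fin (n + 1) → Bool) : (pStr b).count EpSym.x = n := by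
  induction n with
  | zero => cases h : b 0 <;> simp [pStr, symOf, h]
  | succ n ih => rw [pStr_succ_succ]; cases h : b 0 <;> simp [symOf, ih]

theorem count_x_sStr {n : ℕ} (a : Fin (n + 1) → Bool) : (sStr a).count EpSym.x = n := by
  induction n with
  | zero => cases h : a 0 <;> simp [sStr, List.intercalate, coordGadget, h]
  | succ n ih => rw [sStr_succ_succ]; cases h : a 0 <;> simp [coordGadget, ih]

theorem symOf_cons_sublist_coordGadget_append_iff {u v : Bool} {P S : List EpSym}
    (h : P.count EpSym.x = S.count EpSym.x) :
    (symOf v :: EpSym.x :: P).Sublist (coordGadget u ++ EpSym.x :: S) ↔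
      (u && v) = false ∧ P.Sublist S := by
  have not_sublist (c : EpSym) : ¬ (c :: EpSym.x :: P).Sublist S := fun hs => by
    have := hs.count_le EpSym.x
    rw [List.count_cons, List.count_cons_self] at this
    omega
  have not_sublist' : ¬ (EpSym.x :: P).Sublist S := fun hs => by
    have := hs.count_le EpSym.x
    rw [List.count_cons_self] at this
    omega
  cases u <;> cases v <;>
    simp [symOf, coordGadget, List.sublist_cons_iff, not_sublist, not_sublist']

theorem orthogonal_succ_iff {n : ℕ} (a b : Fin (n + 1) → Bool) :
    Orthogonal a b ↔
      (a 0 && b 0) = false ∧ Orthogonal (fun i => a i.succ) fun i => b i.succ :=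
  Fin.forall_fin_succ

/-- For d ≥ 1 and a, b ∈ {0,1}^d, the string p(b) is a subsequence of s(a)
if and only if a and b are orthogonal. -/
theorem pStr_sublist_sStr_iff_orthogonal {d : ℕ} (hd : 1 ≤ d)
    (a b : Fin d → Bool) :
    (pStr b).Sublist (sStr a) ↔ Orthogonal a b := by
  obtain ⟨n, rfl⟩ := Nat.exists_eq_add_of_le' hd
  clear hd
  induction n with
  | zero =>
    cases ha : a 0 <;> cases hb : b 0 <;>
      simp [pStr, sStr, List.intercalate, symOf, coordGadget, Orthogonal, ha, hb]
  | succ n ih =>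
    rw [pStr_succ_succ, sStr_succ_succ, symOf_cons_sublist_coordGadget_append_iff
      ((count_x_pStr _).trans (count_x_sStr _).symm), ih, orthogonal_succ_iff a b]
end

section
/- Let d ≥ 1 and let z ∈ {0,1}^d be the all-zeros vector. For every vector b ∈ {0,1}^d, the string p(b) is a subsequence of the string s(z). -/
/-- The all-zeros vector z ∈ {0,1}^d. -/
def zVec (d : ℕ) : Fin d → Bool := fun _ => false

/-- Choosing one letter from each block and separating the choices by `x` gives a subsequence
of the blocks separated by `x`. -/
theorem List.Forall₂.intersperse_sublist_intercalate {α : Type*} (x : α) {l : List α}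
    {L : List (List α)} (h : List.Forall₂ (fun a g => a ∈ g) l L) :
    (List.intersperse x l).Sublist (List.intercalate [x] L) := by
  induction h with
  | nil => simp
  | @cons a g l L hag h ih =>
    cases h with
    | nil => simpa [List.intercalate] using hag
    | cons _ _ =>
      have key := (List.singleton_sublist.mpr hag).append (ih.cons_cons x)
      simpa [List.intercalate] using key

/-- Both letters 0 and 1 occur in the gadget of the coordinate 0. -/
theorem symOf_mem_coordGadget_false (v : Bool) : symOf v ∈ coordGadget false := by
  cases v <;> simp [symOf, coordGadget]

/-- For d ≥ 1 and any b ∈ {0,1}^d, the string p(b) is a subsequence of s(z),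
where z is the all-zeros vector. -/
theorem pStr_sublist_sStr_zero {d : ℕ} (hd : 1 ≤ d) (b : Fin d → Bool) :
    (pStr b).Sublist (sStr (zVec d)) := by
  refine List.Forall₂.intersperse_sublist_intercalate EpSym.x ?_
  rw [List.forall₂_iff_get]
  refine ⟨by simp, fun i _ _ => ?_⟩
  simpa [zVec] using symOf_mem_coordGadget_false _
end

section
/- Let d, n, m ≥ 1 with m ≤ n, and let A = (a_1, …, a_n) and B = (b_1, …, b_m) be sequences of vectors in {0,1}^d. Then there exists a substring T of S of length exactly 3d(2m−1)+1 such that P is a subsequence of T. -/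
/-- The pattern P = $ p(b₁) $ p(b₂) $ ⋯ $ p(bₘ) $. -/
def Pstr {d m : ℕ} (B : Fin m → Fin d → Bool) : List EpSym :=
  [EpSym.dollar] ++ (List.ofFn fun j => pStr (B j) ++ [EpSym.dollar]).flatten

/-- One copy of the concatenation s(a₁) $ s(z) $ s(a₂) $ s(z) $ ⋯ s(aₙ) $ s(z) $. -/
def Shalf {d n : ℕ} (A : Fin n → Fin d → Bool) : List EpSym :=
  (List.ofFn fun i =>
    sStr (A i) ++ [EpSym.dollar] ++ sStr (zVec d) ++ [EpSym.dollar]).flatten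

/-- The text S = $ s(z) $ followed by two consecutive copies of
s(a₁) $ s(z) $ ⋯ s(aₙ) $ s(z) $. -/
def Sstr {d n : ℕ} (A : Fin n → Fin d → Bool) : List EpSym :=
  [EpSym.dollar] ++ sStr (zVec d) ++ [EpSym.dollar] ++ Shalf A ++ Shalf A

theorem length_coordGadget (v : Bool) : (coordGadget v).length = 2 := by
  cases v <;> rfl

theorem length_intercalate_coordGadget (v : Bool) (l : List Bool) :
    (List.intercalate [EpSym.x] ((v :: l).map coordGadget)).length = 3 * l.length + 2 := by
  induction l generalizing v with
  | nil => simp [length_coordGadget]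
  | cons w l ih =>
    have h := ih w
    simp only [List.map_cons] at h
    simp only [List.map_cons, List.intercalate_cons_cons, List.length_append, h,
      length_coordGadget, List.length_cons, List.length_nil]
    omega

theorem length_sStr {d : ℕ} (hd : 1 ≤ d) (a : Fin d → Bool) :
    (sStr a).length + 1 = 3 * d := by
  obtain ⟨d, rfl⟩ := Nat.exists_eq_add_of_le' hd
  have h := length_intercalate_coordGadget (a 0) (List.ofFn fun i : Fin d => a i.succ)
  simp only [List.map_cons, List.map_ofFn, List.length_ofFn] at h
  simp only [sStr, List.ofFn_succ]
  simp only [Function.comp_def] at h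
  omega

theorem symOf_sublist_coordGadget_false (v : Bool) :
    [symOf v].Sublist (coordGadget false) := by
  cases v <;> decide

theorem intersperse_symOf_sublist (l : List Bool) :
    (List.intersperse EpSym.x (l.map symOf)).Sublist
      (List.intercalate [EpSym.x] (l.map fun _ => coordGadget false)) := by
  induction l with
  | nil => simp
  | cons v l ih =>
    cases l with
    | nil => simpa using symOf_sublist_coordGadget_false v
    | cons w l =>
      simp only [List.map_cons, List.intercalate_cons_cons,
        List.intersperse_cons_cons] at ih ⊢
      rw [List.append_assoc]
      exact (symOf_sublist_coordGadget_false v).append (ih.cons_cons EpSym.x)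

theorem pStr_sublist_sStr_zVec {d : ℕ} (b : Fin d → Bool) :
    (pStr b).Sublist (sStr (zVec d)) := by
  have h := intersperse_symOf_sublist (List.ofFn b)
  simp only [List.map_ofFn] at h
  exact h

theorem List.Sublist.flatten_ofFn {α : Type*} {k : ℕ} {f g : Fin k → List α}
    (h : ∀ i, (f i).Sublist (g i)) : (List.ofFn f).flatten.Sublist (List.ofFn g).flatten := by
  induction k with
  | zero => simp
  | succ k ih =>
    simp only [List.ofFn_succ, List.flatten_cons]
    exact (h 0).append (ih fun i => h i.succ)

theorem length_Shalf {d n : ℕ} (hd : 1 ≤ d) (A : Fin n → Fin d → Bool) :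
    (Shalf A).length = 6 * d * n := by
  have h : ∀ i, (sStr (A i) ++ [EpSym.dollar] ++ sStr (zVec d) ++ [EpSym.dollar]).length
      = 6 * d := by
    intro i
    have h₁ := length_sStr hd (A i)
    have h₂ := length_sStr hd (zVec d)
    simp only [List.length_append, List.length_cons, List.length_nil]
    omega
  simp only [Shalf, List.length_flatten, List.map_ofFn, Function.comp_def, h]
  simp [mul_comm]

theorem Shalf_castLE_prefix {d n k : ℕ} (h : k ≤ n) (A : Fin n → Fin d → Bool) :
    Shalf (fun i : Fin k => A (i.castLE h)) <+: Shalf A := by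
  obtain ⟨r, rfl⟩ := Nat.exists_eq_add_of_le h
  simp only [Shalf, List.ofFn_add, List.flatten_append]
  exact List.prefix_append _ _

/-- For d, n, m ≥ 1 with m ≤ n, there exists a substring T of S of length
exactly 3d(2m−1)+1 such that P is a subsequence of T. -/
theorem exists_substring_length_eq {d n m : ℕ} (hd : 1 ≤ d) (hn : 1 ≤ n)
    (hm : 1 ≤ m) (hmn : m ≤ n)
    (A : Fin n → Fin d → Bool) (B : Fin m → Fin d → Bool) :
    ∃ T : List EpSym, T <:+: Sstr A ∧ T.length = 3 * d * (2 * m - 1) + 1 ∧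
      (Pstr B).Sublist T := by
  obtain ⟨k, rfl⟩ := Nat.exists_eq_add_of_le' hm
  have hk : k ≤ n := by omega
  refine ⟨[EpSym.dollar] ++ sStr (zVec d) ++ [EpSym.dollar] ++
    Shalf (fun i : Fin k => A (i.castLE hk)), ?_, ?_, ?_⟩
  · refine List.IsPrefix.isInfix ?_
    exact ((List.prefix_append_right_inj _).2 (Shalf_castLE_prefix hk A)).trans
      (List.prefix_append _ _)
  · have h := length_sStr hd (zVec d)
    simp only [List.length_append, List.length_cons, List.length_nil, length_Shalf hd]
    have hk' : 2 * (k + 1) - 1 = 2 * k + 1 := by omega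
    rw [hk']
    linarith
  · simp only [Pstr, List.ofFn_succ, List.flatten_cons, ← List.append_assoc]
    refine List.Sublist.append ?_ (List.Sublist.flatten_ofFn fun i => ?_)
    · exact ((pStr_sublist_sStr_zVec _).append_left _).append_right _
    · rw [List.append_assoc]
      exact List.Sublist.trans ((pStr_sublist_sStr_zVec _).append_right _)
        (List.sublist_append_right _ _)
end

section
/- Let d, n, m ≥ 1 with m ≤ n, and let A = (a_1, …, a_n) and B = (b_1, …, b_m) be sequences of vectors in {0,1}^d. If there is no pair (a_i, b_j) with a_i and b_j orthogonal, then every substring T of S such that P is a subsequence of T has length at least 3d(2m−1)+1. -/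
/-- The concatenation of the words in `l`, each followed by a dollar symbol. -/
def terminated (l : List (List EpSym)) : List EpSym :=
  l.flatMap fun w => w ++ [EpSym.dollar]

/-- Every second word of the list satisfies `Bad`; the first word is one of them iff the
Boolean is `true`. -/
def AlternatelyBad (Bad : List EpSym → Prop) : Bool → List (List EpSym) → Prop
  | _, [] => True
  | c, q :: l => (c = true → Bad q) ∧ AlternatelyBad Bad (!c) l

theorem terminated_cons (q : List EpSym) (l : List (List EpSym)) :
    terminated (q :: l) = q ++ EpSym.dollar :: terminated l := by
  simp [terminated]

theorem terminated_append (l l' : List (List EpSym)) :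
    terminated (l ++ l') = terminated l ++ terminated l' := by
  simp [terminated]

section Sublist

variable {α : Type*}

theorem cons_sublist_of_cons_sublist_append {s : α} {P q T : List α} (hq : s ∉ q)
    (h : (s :: P).Sublist (q ++ s :: T)) : P.Sublist T := by
  induction q with
  | nil => simpa using h
  | cons a q ih =>
    simp only [List.mem_cons, not_or] at hq
    cases h with
    | cons _ h => exact ih hq.2 h
    | cons_cons _ h => exact absurd rfl hq.1

theorem sublist_append_cons_split {s : α} {p P q T : List α} (hq : s ∉ q)
    (h : (p ++ s :: P).Sublist (q ++ s :: T)) :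
    (p.Sublist q ∧ P.Sublist T) ∨ (s :: P).Sublist T := by
  obtain ⟨r₁, r₂, hr, h₁, h₂⟩ := List.append_sublist_iff.1 h
  rcases List.append_eq_append_iff.1 hr with ⟨a, ha, ha'⟩ | ⟨a, ha, ha'⟩
  · cases a with
    | nil =>
      simp only [List.append_nil, List.nil_append] at ha ha'
      subst ha ha'
      exact Or.inl ⟨h₁, by simpa using h₂⟩
    | cons b a =>
      simp only [List.cons_append, List.cons.injEq] at ha'
      rw [ha'.2]
      exact Or.inr (h₂.trans (List.sublist_append_right _ _))
  · subst ha ha'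
    refine Or.inl ⟨h₁.trans (List.sublist_append_left _ _), ?_⟩
    exact cons_sublist_of_cons_sublist_append (fun hs => hq (by simp [hs])) h₂

theorem prefix_append_cons {s : α} {T q R : List α} (h : T <+: q ++ s :: R) :
    T <+: q ∨ ∃ T', T = q ++ s :: T' ∧ T' <+: R := by
  induction q generalizing T with
  | nil =>
    cases T with
    | nil => simp
    | cons t T =>
      simp only [List.nil_append, List.cons_prefix_cons] at h
      exact Or.inr ⟨T, by simp [h.1], h.2⟩
  | cons a q ih =>
    cases T with
    | nil => simp
    | cons t T =>
      simp only [List.cons_append, List.cons_prefix_cons] at h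
      obtain ⟨rfl, h⟩ := h
      rcases ih h with h | ⟨T', rfl, h'⟩
      · exact Or.inl (by simpa using h)
      · exact Or.inr ⟨T', rfl, h'⟩

theorem cons_suffix_append {s : α} {w q R : List α} (hq : s ∉ q)
    (h : s :: w <:+ q ++ R) : s :: w <:+ R := by
  induction q with
  | nil => exact h
  | cons a q ih =>
    simp only [List.mem_cons, not_or] at hq
    rw [List.cons_append, List.suffix_cons_iff] at h
    rcases h with h | h
    · simp only [List.cons.injEq] at h
      exact absurd h.1 hq.1
    · exact ih hq.2 h

end Sublist

theorem length_bound_of_alternatelyBad {Bad : List EpSym → Prop} {L : ℕ}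
    (blocks : List (List EpSym)) :
    ∀ (c : Bool) (T : List EpSym) (ps : List (List EpSym)),
    AlternatelyBad Bad c blocks →
    (∀ q ∈ blocks, EpSym.dollar ∉ q ∧ q.length + 1 = L) →
    (∀ p ∈ ps, ∀ q, Bad q → ¬ p.Sublist q) →
    T <+: terminated blocks →
    ((terminated ps).Sublist T →
      2 * (L * ps.length) ≤ T.length + (if c then 0 else L)) ∧
    ((EpSym.dollar :: terminated ps).Sublist T →
      2 * (L * ps.length) + (if c then 0 else L) ≤ T.length) := by
  induction blocks with
  | nil =>
    intro c T ps _ _ _ hT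
    obtain rfl : T = [] := by simpa [terminated] using hT
    cases ps with
    | nil => simp
    | cons p ps => simp [terminated_cons]
  | cons q blocks ih =>
    intro c T ps halt hblocks hps hT
    obtain ⟨hc, halt⟩ := halt
    obtain ⟨hq, hL⟩ := hblocks q (by simp)
    have ih := fun T ps => ih (!c) T ps halt (fun q hq => hblocks q (by simp [hq]))
    rw [terminated_cons] at hT
    rcases prefix_append_cons hT with hT | ⟨T', rfl, hT'⟩
    · have hdT : EpSym.dollar ∉ T := fun h => hq (hT.subset h)
      refine ⟨fun h => ?_, fun h => absurd (h.subset (by simp)) hdT⟩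
      cases ps with
      | nil => simp
      | cons p ps =>
        rw [terminated_cons] at h
        exact absurd (h.subset (by simp)) hdT
    · have hlen : (q ++ EpSym.dollar :: T').length = L + T'.length := by
        simp only [List.length_append, List.length_cons]; omega
      rw [hlen]
      constructor
      · intro h
        cases ps with
        | nil => simp
        | cons p ps =>
          have hps' : ∀ p ∈ ps, ∀ q, Bad q → ¬ p.Sublist q :=
            fun p hp => hps p (by simp [hp])
          rw [terminated_cons] at h
          rw [List.length_cons, Nat.mul_succ]
          rcases sublist_append_cons_split hq h with ⟨h₁, h₂⟩ | h
          · have := (ih T' ps hps' hT').1 h₂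
            cases c with
            | false => simp at this ⊢; omega
            | true => exact absurd h₁ (hps p (by simp) q (hc rfl))
          · have := (ih T' ps hps' hT').2 h
            cases c <;> simp at this ⊢ <;> omega
      · intro h
        have := (ih T' ps hps hT').1 (cons_sublist_of_cons_sublist_append hq h)
        cases c <;> simp at this ⊢ <;> omega

theorem exists_terminated_of_suffix {Bad : List EpSym → Prop}
    (blocks : List (List EpSym)) :
    ∀ (c : Bool) (w : List EpSym), AlternatelyBad Bad c blocks →
    (∀ q ∈ blocks, EpSym.dollar ∉ q) →
    EpSym.dollar :: w <:+ EpSym.dollar :: terminated blocks →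
    ∃ c' blocks', w = terminated blocks' ∧ AlternatelyBad Bad c' blocks' ∧
      blocks' ⊆ blocks := by
  induction blocks with
  | nil =>
    intro c w halt _ h
    rcases List.suffix_cons_iff.1 h with h | h
    · exact ⟨c, [], by simpa using h, halt, by simp⟩
    · simp [terminated] at h
  | cons q blocks ih =>
    intro c w halt hq h
    rcases List.suffix_cons_iff.1 h with h | h
    · exact ⟨c, q :: blocks, by simpa using h, halt, by simp⟩
    · rw [terminated_cons] at h
      obtain ⟨c', l, h₁, h₂, h₃⟩ := ih (!c) w halt.2 (fun q' h' => hq q' (by simp [h']))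
        (cons_suffix_append (hq q (by simp)) h)
      exact ⟨c', l, h₁, h₂, fun a ha => by simp [h₃ ha]⟩

theorem AlternatelyBad.flatMap_pair_append {Bad : List EpSym → Prop} {α : Type*}
    {f : α → List EpSym} {z : List EpSym} {r : List (List EpSym)}
    (hr : AlternatelyBad Bad true r) :
    ∀ l : List α, (∀ a ∈ l, Bad (f a)) →
      AlternatelyBad Bad true (l.flatMap (fun a => [f a, z]) ++ r)
  | [], _ => by simpa using hr
  | a :: l, h => by
    have := flatMap_pair_append (z := z) hr l (fun b hb => h b (by simp [hb]))
    simp [AlternatelyBad, h a (by simp), this]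

theorem intercalate_coordGadget_spec (l : List Bool) (hl : l ≠ []) :
    (List.intercalate [EpSym.x] (l.map coordGadget)).length + 1 = 3 * l.length ∧
    (List.intercalate [EpSym.x] (l.map coordGadget)).count EpSym.x + 1 = l.length ∧
    EpSym.dollar ∉ List.intercalate [EpSym.x] (l.map coordGadget) := by
  induction l with
  | nil => exact absurd rfl hl
  | cons a l ih =>
    cases l with
    | nil => cases a <;> simp [coordGadget]
    | cons b l =>
      obtain ⟨h₁, h₂, h₃⟩ := ih (by simp)
      simp only [List.map_cons, List.length_cons] at h₁ h₂ h₃ ⊢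
      rw [List.intercalate_cons_cons]
      generalize List.intercalate [EpSym.x] (coordGadget b :: l.map coordGadget) = w at *
      cases a <;> simp [coordGadget, h₃] <;> omega

theorem count_x_intersperse_symOf (l : List Bool) (hl : l ≠ []) :
    (List.intersperse EpSym.x (l.map symOf)).count EpSym.x + 1 = l.length := by
  induction l with
  | nil => exact absurd rfl hl
  | cons a l ih =>
    cases l with
    | nil => cases a <;> simp [symOf]
    | cons b l =>
      have h := ih (by simp)
      simp only [List.map_cons, List.length_cons] at h ⊢
      rw [List.intersperse_cons_cons]
      cases a <;> simp [symOf] <;> simpa [symOf] using h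

theorem and_eq_false_of_symOf_sublist {a b : Bool}
    (h : [symOf b].Sublist (coordGadget a)) : (a && b) = false := by
  cases a <;> cases b <;> simp_all [symOf, coordGadget]

theorem forall₂_of_intersperse_sublist (la lb : List Bool) (hlen : la.length = lb.length)
    (h : (List.intersperse EpSym.x (lb.map symOf)).Sublist
      (List.intercalate [EpSym.x] (la.map coordGadget))) :
    List.Forall₂ (fun a b => (a && b) = false) la lb := by
  induction la generalizing lb with
  | nil =>
    obtain rfl : lb = [] := by simpa using hlen.symm
    exact .nil
  | cons a la ih =>
    cases lb with
    | nil => simp at hlen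
    | cons b lb =>
      have hlen' : la.length = lb.length := by simpa using hlen
      cases la with
      | nil =>
        obtain rfl : lb = [] := by simpa using hlen'.symm
        exact .cons (and_eq_false_of_symOf_sublist (by simpa using h)) .nil
      | cons a' la =>
        cases lb with
        | nil => simp at hlen'
        | cons b' lb =>
          simp only [List.map_cons] at h
          rw [List.intercalate_cons_cons, List.intersperse_cons_cons] at h
          have hx : EpSym.x ∉ coordGadget a := by cases a <;> simp [coordGadget]
          rcases sublist_append_cons_split (p := [symOf b]) hx (by simpa using h)
            with ⟨h₁, h₂⟩ | h₂
          · exact .cons (and_eq_false_of_symOf_sublist h₁) (ih _ hlen' (by simpa using h₂))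
          · have hcount := h₂.count_le EpSym.x
            have hp := count_x_intersperse_symOf (b' :: lb) (by simp)
            have hs := (intercalate_coordGadget_spec (a' :: la) (by simp)).2.1
            simp only [List.map_cons, List.count_cons_self] at hcount hp hs
            omega

theorem sStr_eq {d : ℕ} (a : Fin d → Bool) :
    sStr a = List.intercalate [EpSym.x] ((List.ofFn a).map coordGadget) := by
  rw [sStr, List.map_ofFn]; rfl

theorem pStr_eq {d : ℕ} (b : Fin d → Bool) :
    pStr b = List.intersperse EpSym.x ((List.ofFn b).map symOf) := by
  rw [pStr, List.map_ofFn]; rfl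

theorem orthogonal_of_pStr_sublist_sStr {d : ℕ} {a b : Fin d → Bool}
    (h : (pStr b).Sublist (sStr a)) : Orthogonal a b := by
  rw [sStr_eq, pStr_eq] at h
  have := (List.forall₂_iff_get.1
    (forall₂_of_intersperse_sublist _ _ (by simp) h)).2
  intro i
  simpa using this i (by simp) (by simp)

theorem sStr_spec {d : ℕ} (hd : 1 ≤ d) (a : Fin d → Bool) :
    EpSym.dollar ∉ sStr a ∧ (sStr a).length + 1 = 3 * d := by
  have hne : List.ofFn a ≠ [] := by
    rw [Ne, List.ofFn_eq_nil_iff]; omega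
  have h := intercalate_coordGadget_spec _ hne
  rw [← sStr_eq, List.length_ofFn] at h
  exact ⟨h.2.2, h.1⟩

/-- The words of one half of the text, in order. -/
def halfBlocks {d n : ℕ} (A : Fin n → Fin d → Bool) : List (List EpSym) :=
  (List.ofFn A).flatMap fun a => [sStr a, sStr (zVec d)]

theorem Shalf_eq {d n : ℕ} (A : Fin n → Fin d → Bool) :
    Shalf A = terminated (halfBlocks A) := by
  have hA : Shalf A = (List.ofFn A).flatMap fun a => terminated [sStr a, sStr (zVec d)] := by
    rw [Shalf, List.flatMap, List.map_ofFn]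
    congr 2
    funext i
    simp [terminated]
  rw [hA, halfBlocks, terminated, List.flatMap_assoc]
  rfl

theorem Sstr_eq {d n : ℕ} (A : Fin n → Fin d → Bool) :
    Sstr A = EpSym.dollar ::
      terminated (sStr (zVec d) :: (halfBlocks A ++ halfBlocks A)) := by
  simp [Sstr, Shalf_eq, terminated_cons, terminated_append]

theorem Pstr_eq {d m : ℕ} (B : Fin m → Fin d → Bool) :
    Pstr B = EpSym.dollar :: terminated (List.ofFn fun j => pStr (B j)) := by
  rw [Pstr, terminated, List.flatMap, List.map_ofFn]
  rfl

/-- If no pair (aᵢ, bⱼ) is orthogonal, then every substring T of S containing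
P as a subsequence has length at least 3d(2m−1)+1. -/
theorem substring_length_lower_bound {d n m : ℕ} (hd : 1 ≤ d) (hn : 1 ≤ n)
    (hm : 1 ≤ m) (hmn : m ≤ n)
    (A : Fin n → Fin d → Bool) (B : Fin m → Fin d → Bool)
    (horth : ¬ ∃ (i : Fin n) (j : Fin m), Orthogonal (A i) (B j)) :
    ∀ T : List EpSym, T <:+: Sstr A → (Pstr B).Sublist T →
      3 * d * (2 * m - 1) + 1 ≤ T.length := by
  intro T hT hP
  set Bad : List EpSym → Prop := fun q => ∀ j, ¬ (pStr (B j)).Sublist q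
  have hA : ∀ a ∈ List.ofFn A, Bad (sStr a) := by
    intro a ha j hj
    obtain ⟨i, rfl⟩ := (List.mem_ofFn' _ _).1 ha
    exact horth ⟨i, j, orthogonal_of_pStr_sublist_sStr hj⟩
  have halt : AlternatelyBad Bad false
      (sStr (zVec d) :: (halfBlocks A ++ halfBlocks A)) := by
    refine ⟨by simp, AlternatelyBad.flatMap_pair_append ?_ _ hA⟩
    simpa [halfBlocks] using
      AlternatelyBad.flatMap_pair_append (r := []) (z := sStr (zVec d)) trivial _ hA
  have hblocks : ∀ q ∈ sStr (zVec d) :: (halfBlocks A ++ halfBlocks A),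
      EpSym.dollar ∉ q ∧ q.length + 1 = 3 * d := by
    intro q hq
    have : ∃ a : Fin d → Bool, q = sStr a := by
      simp only [halfBlocks, List.mem_cons, List.mem_append, List.mem_flatMap,
        List.not_mem_nil, or_false] at hq
      rcases hq with h | ⟨a, -, h | h⟩ | ⟨a, -, h | h⟩ <;> exact ⟨_, h⟩
    obtain ⟨a, rfl⟩ := this
    exact sStr_spec hd a
  rw [Pstr_eq] at hP
  obtain ⟨r, v, rfl, hr, hv⟩ := List.cons_sublist_iff.1 hP
  obtain ⟨r₁, r₂, rfl⟩ := List.append_of_mem hr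
  obtain ⟨s, t, hst⟩ := hT
  rw [Sstr_eq] at hst
  obtain ⟨c, l, hl, hlalt, hsub⟩ := exists_terminated_of_suffix _ false (r₂ ++ v ++ t) halt
    (fun q hq => (hblocks q hq).1) ⟨s ++ r₁, by simpa using hst⟩
  have hbound := (length_bound_of_alternatelyBad l c (r₂ ++ v)
    (List.ofFn fun j => pStr (B j)) hlalt (fun q hq => hblocks q (hsub hq))
    (by
      intro p hp q hq
      obtain ⟨j, rfl⟩ := (List.mem_ofFn' _ _).1 hp
      exact hq j)
    ⟨t, hl⟩).1 (hv.trans (List.sublist_append_right _ _))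
  have hc : (if c then 0 else 3 * d) ≤ 3 * d := by split <;> omega
  obtain ⟨k, rfl⟩ : ∃ k, m = k + 1 := ⟨m - 1, by omega⟩
  have hk : 3 * d * (2 * (k + 1) - 1) + 3 * d = 2 * (3 * d * (k + 1)) := by
    rw [show 2 * (k + 1) - 1 = 2 * k + 1 by omega]; ring
  simp only [List.length_ofFn, List.length_append, List.length_cons] at hbound ⊢
  omega
end

section
/- Let X and Y be strings over an alphabet Σ and let c ∈ Σ be a character that occurs exactly k times in X and exactly k times in Y. Then every alignment of Y in X aligns, for each 1 ≤ i ≤ k, the position of the i-th occurrence of c in Y to the position of the i-th occurrence of c in X. -/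
/-- A strictly increasing list contained in a strictly increasing list that is no longer
equals it. -/
theorem List.Pairwise.eq_of_subset_of_length_le {l₁ l₂ : List ℕ}
    (h₁ : l₁.Pairwise (· < ·)) (h₂ : l₂.Pairwise (· < ·)) (hsub : l₁ ⊆ l₂)
    (hlen : l₂.length ≤ l₁.length) : l₁ = l₂ :=
  ((List.subperm_of_subset h₁.nodup hsub).perm_of_length_le hlen).eq_of_pairwise' h₁ h₂


/-- Let c be a character that occurs exactly k times in X and exactly k times
in Y. Then every alignment of Y in X (a strictly increasing map of positions
witnessing that Y is a subsequence of X) aligns, for each i < k, the position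
of the i-th occurrence of c in Y to the position of the i-th occurrence of c
in X. (Occurrence positions are given by `List.indexesOf`, the increasing
list of positions holding c.) -/
theorem alignment_matches_occurrences {σ : Type*} [DecidableEq σ]
    (X Y : List σ) (c : σ) (k : ℕ)
    (hX : X.count c = k) (hY : Y.count c = k)
    (f : Fin Y.length → Fin X.length) (hmono : StrictMono f)
    (halign : ∀ ℓ : Fin Y.length, Y.get ℓ = X.get (f ℓ)) :
    ∀ i : ℕ, i < k →
      ∀ hy : (Y.indexesOf c).getD i 0 < Y.length,
        (f ⟨(Y.indexesOf c).getD i 0, hy⟩ : ℕ) = (X.indexesOf c).getD i 0 := by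
  intro i hi hy
  have hmap : (Y.idxsOf c).pmap (fun n (hn : n < Y.length) => (f ⟨n, hn⟩ : ℕ))
      (fun n hn => by simpa using List.lt_add_of_mem_idxsOf n hn) = X.idxsOf c := by
    apply List.Pairwise.eq_of_subset_of_length_le
    · apply List.Pairwise.pmap List.pairwise_idxsOf
      intro a ha b hb hab
      exact hmono hab
    · exact List.pairwise_idxsOf
    · intro m hm
      obtain ⟨n, hn, rfl⟩ := List.mem_pmap.1 hm
      obtain ⟨hlt, hc⟩ := List.mem_idxsOf_iff_exists_getElem_pos.1 hn
      refine List.mem_idxsOf_iff_exists_getElem_pos.2 ⟨(f ⟨n, hlt⟩).isLt, ?_⟩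
      have := halign ⟨n, hlt⟩
      simp only [List.get_eq_getElem] at this
      rwa [← this]
    · simp [hX, hY]
  have hiY : i < (Y.idxsOf c).length := by
    rwa [List.length_idxsOf, hY]
  have hget := List.getD_eq_getElem (X.idxsOf c) 0 (by rwa [List.length_idxsOf, hX] : i < _)
  simp only [← hmap, List.getElem_pmap] at hget
  simp only [List.indexesOf, List.getD_eq_getElem _ _ hiY, ← hmap, hget]
end
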